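/- arXiv:1810.02377 — 2 statements merged into one kernel-verified Lean document; each statement's English description precedes it below -/
import Mathlib

section
/- For all integers m ≥ 1 and n ≥ 1, the integer Σ_{d ∣ n} μ(n/d) · (−1)^{(m−1)(n−d)} · C(dm−1, d−1) is a nonnegative multiple of n²; that is, there exists a natural number DT_n^{(m)} with Σ_{d ∣ n} μ(n/d) (−1)^{(m−1)(n−d)} C(dm−1, d−1) = n² · DT_n^{(m)}. -/
open Finset

/-- The product of `x + j` over the `j ≤ (q + 1) * N` that are not multiples of `q + 1`. -/
def coprimeProd (q N : ℕ) (x : ℤ) : ℤ :=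
  ∏ i ∈ range N, ∏ r ∈ range q, (x + ((q + 1) * i + r + 1))

lemma prod_range_mul_eq_coprimeProd (q N : ℕ) (M : ℤ) :
    ∏ j ∈ range ((q + 1) * N), ((q + 1) * M + j + 1) =
      coprimeProd q N ((q + 1) * M) * ((q + 1) ^ N * ∏ i ∈ range N, (M + i + 1)) := by
  induction N with
  | zero => simp [coprimeProd]
  | succ N ih =>
    have hblock : ∏ r ∈ range q, ((q + 1) * M + (((q + 1) * N + r : ℕ) : ℤ) + 1) =
        ∏ r ∈ range q, ((q + 1) * M + (((q + 1) * N + r + 1) : ℤ)) :=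
      prod_congr rfl fun r _ => by push_cast; ring
    rw [mul_add_one, prod_range_add, ih, prod_range_succ _ q, hblock]
    simp only [coprimeProd, prod_range_succ _ N]
    push_cast
    ring

lemma prod_range_add_add_one_eq_factorial_mul_choose (M n : ℕ) :
    ∏ j ∈ range n, ((M : ℤ) + j + 1) = n.factorial * (M + n).choose n := by
  have h := Nat.ascFactorial_eq_factorial_mul_choose M n
  rw [Nat.ascFactorial_eq_prod_range] at h
  rw [← Nat.cast_mul, ← h, Nat.cast_prod]
  exact prod_congr rfl fun j _ => by push_cast; ring

lemma choose_mul_coprimeProd (q N M : ℕ) :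
    (((q + 1) * M + (q + 1) * N).choose ((q + 1) * N) : ℤ) * coprimeProd q N 0 =
      (M + N).choose N * coprimeProd q N ((q + 1) * M) := by
  have h := prod_range_mul_eq_coprimeProd q N M
  have h0 := prod_range_mul_eq_coprimeProd q N 0
  have hM := prod_range_add_add_one_eq_factorial_mul_choose ((q + 1) * M) ((q + 1) * N)
  have h00 := prod_range_add_add_one_eq_factorial_mul_choose 0 ((q + 1) * N)
  have hN := prod_range_add_add_one_eq_factorial_mul_choose 0 N
  push_cast at hM h00 hN
  rw [hM, prod_range_add_add_one_eq_factorial_mul_choose] at h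
  simp only [mul_zero, zero_add, Nat.choose_self, Nat.cast_one, mul_one] at h0 h00 hN
  rw [h00, hN] at h0
  rw [h0] at h
  have hne : ((q : ℤ) + 1) ^ N * N.factorial ≠ 0 := by positivity
  apply mul_left_cancel₀ hne
  linear_combination h

lemma coprimeProd_reflect (q N : ℕ) (x : ℤ) :
    coprimeProd q N x =
      ∏ i ∈ range N, ∏ r ∈ range q, (x + (q + 1) * N - ((q + 1) * i + r + 1)) := by
  rw [coprimeProd, ← prod_range_reflect]
  refine prod_congr rfl fun i hi => ?_
  rw [← prod_range_reflect]
  refine prod_congr rfl fun r hr => ?_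
  rw [mem_range] at hi hr
  rw [Nat.sub_sub, Nat.sub_sub, Nat.cast_sub (by lia), Nat.cast_sub (by lia)]
  push_cast
  ring

lemma coprimeProd_sq_modEq (q N : ℕ) (c : ℤ) :
    coprimeProd q N ((q + 1) * (N * c)) ^ 2 ≡ coprimeProd q N 0 ^ 2 [ZMOD ((q + 1) * N) ^ 2] := by
  have hsq (x : ℤ) : coprimeProd q N x ^ 2 = ∏ i ∈ range N, ∏ r ∈ range q,
      ((x + ((q + 1) * i + r + 1)) * (x + (q + 1) * N - ((q + 1) * i + r + 1))) := by
    rw [sq]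
    nth_rewrite 2 [coprimeProd_reflect]
    simp only [coprimeProd, prod_mul_distrib]
  rw [hsq, hsq]
  refine Int.ModEq.prod fun i _ => Int.ModEq.prod fun r _ => ?_
  rw [Int.modEq_iff_dvd]
  exact ⟨-(c ^ 2 + c), by ring⟩

lemma coprimeProd_modEq (q N : ℕ) (x : ℤ) :
    coprimeProd q N ((q + 1) * x) ≡ coprimeProd q N 0 [ZMOD q + 1] := by
  refine Int.ModEq.prod fun i _ => Int.ModEq.prod fun r _ => ?_
  rw [Int.modEq_iff_dvd]
  exact ⟨-x, by ring⟩

lemma not_dvd_coprimeProd_zero {q : ℕ} (hp : (q + 1).Prime) (N : ℕ) :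
    ¬ ((q + 1 : ℕ) : ℤ) ∣ coprimeProd q N 0 := by
  have hp' := Nat.prime_iff_prime_int.mp hp
  rw [coprimeProd, hp'.dvd_finsetProd_iff]
  rintro ⟨i, -, hi⟩
  rw [hp'.dvd_finsetProd_iff] at hi
  obtain ⟨r, hr, h⟩ := hi
  have h' : ((q + 1 : ℕ) : ℤ) ∣ ((r + 1 : ℕ) : ℤ) := by
    obtain ⟨z, hz⟩ := h
    refine ⟨z - i, ?_⟩
    push_cast at hz ⊢
    linear_combination hz
  have := Nat.le_of_dvd r.succ_pos (Int.natCast_dvd_natCast.mp h')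
  rw [mem_range] at hr
  lia

/-- For odd primes `p = q + 1`, the square congruence lifts to the products themselves. -/
lemma pow_dvd_coprimeProd_sub_of_odd {q k N c : ℕ} (hp : (q + 1).Prime) (hq : q ≠ 1)
    (hN : (q + 1) ^ k ∣ N) :
    (((q + 1 : ℕ) : ℤ) ^ (2 * (k + 1))) ∣
      coprimeProd q N ((q + 1) * (N * c)) - coprimeProd q N 0 := by
  have hp' := Nat.prime_iff_prime_int.mp hp
  have hdvd : (((q + 1 : ℕ) : ℤ) ^ (2 * (k + 1))) ∣ (((q + 1 : ℕ) : ℤ) * N) ^ 2 := by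
    rw [mul_comm 2, pow_mul, pow_succ' _ k]
    exact pow_dvd_pow_of_dvd (mul_dvd_mul_left _ (by exact_mod_cast hN)) 2
  have hsq := hdvd.trans (by simpa using (coprimeProd_sq_modEq q N c).symm.dvd)
  rw [sq_sub_sq] at hsq
  refine (IsCoprime.pow_left ?_).dvd_of_dvd_mul_left hsq
  rw [hp'.coprime_iff_not_dvd]
  intro h
  have h1 : ((q + 1 : ℕ) : ℤ) ∣ coprimeProd q N ((q + 1) * (N * c)) - coprimeProd q N 0 := by
    simpa using (coprimeProd_modEq q N (N * c)).symm.dvd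
  have h2 : ((q + 1 : ℕ) : ℤ) ∣ 2 * coprimeProd q N 0 := by
    simpa [two_mul] using dvd_sub h h1
  rcases hp'.dvd_or_dvd h2 with h3 | h3
  · have h4 : q + 1 ∣ 2 := by exact_mod_cast h3
    have := Nat.le_of_dvd two_pos h4
    have := hp.two_le
    lia
  · exact not_dvd_coprimeProd_zero hp N h3

lemma coprimeProd_one_two_mul (u : ℕ) (x : ℤ) :
    coprimeProd 1 (2 * u) x =
      ∏ i ∈ range u, ((x + (2 * i + 1)) * (x + 4 * u - (2 * i + 1))) := by
  have h (N : ℕ) : coprimeProd 1 N x = ∏ i ∈ range N, (x + (2 * i + 1)) := by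
    simp only [coprimeProd, prod_range_one]
    exact prod_congr rfl fun i _ => by push_cast; ring
  rw [h, two_mul, prod_range_add, prod_mul_distrib]
  congr 1
  rw [← prod_range_reflect]
  refine prod_congr rfl fun i hi => ?_
  rw [mem_range] at hi
  rw [Nat.sub_sub]
  push_cast [show 1 + i ≤ u by lia]
  ring

lemma two_pow_dvd_coprimeProd_sub {k N c : ℕ} (hN : 2 ^ k ∣ N) :
    (2 : ℤ) ^ (2 * (k + 1)) ∣
      coprimeProd 1 N (2 * (N * c)) - (-1) ^ (c * N) * coprimeProd 1 N 0 := by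
  rcases Nat.even_or_odd N with he | ho
  · obtain ⟨u, rfl⟩ := he.two_dvd
    rw [(he.mul_left c).neg_one_pow, one_mul]
    have hdvd : (2 : ℤ) ^ (2 * (k + 1)) ∣ (2 * (2 * u : ℕ)) ^ 2 := by
      rw [mul_comm 2, pow_mul, pow_succ' _ k]
      exact pow_dvd_pow_of_dvd (mul_dvd_mul_left _ (by exact_mod_cast hN)) 2
    refine hdvd.trans (Int.ModEq.dvd (Int.ModEq.symm ?_))
    rw [coprimeProd_one_two_mul, coprimeProd_one_two_mul]
    refine Int.ModEq.prod fun i _ => ?_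
    rw [Int.modEq_iff_dvd]
    exact ⟨-(c ^ 2 + c : ℤ), by push_cast; ring⟩
  · have hk : k = 0 := by
      by_contra hk
      exact Nat.not_even_iff_odd.mpr ho (even_iff_two_dvd.mpr ((dvd_pow_self 2 hk).trans hN))
    subst hk
    have hconst : (-1 : ℤ) ^ (c * N) * coprimeProd 1 N 0 =
        ∏ i ∈ range N, ∏ r ∈ range 1,
          ((-1 : ℤ) ^ c * (0 + (((1 : ℕ) + 1) * i + r + 1))) := by
      simp only [prod_mul_distrib, prod_const, card_range, coprimeProd, pow_mul, pow_one]
    rw [hconst]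
    refine Int.ModEq.dvd (Int.ModEq.symm ?_)
    refine Int.ModEq.prod fun i _ => Int.ModEq.prod fun r hr => ?_
    obtain rfl : r = 0 := by simpa using hr
    obtain ⟨v, rfl⟩ := ho
    rw [Int.modEq_iff_dvd]
    rcases Nat.even_or_odd c with hc | hc
    · rw [hc.neg_one_pow]
      obtain ⟨w, rfl⟩ := hc
      exact ⟨-((2 * v + 1) * w), by push_cast; ring⟩
    · rw [hc.neg_one_pow]
      obtain ⟨w, rfl⟩ := hc
      exact ⟨-((2 * v + 1) * w + v + i + 1), by push_cast; ring⟩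

lemma prime_pow_dvd_coprimeProd_sub {q k N c : ℕ} (hp : (q + 1).Prime) (hN : (q + 1) ^ k ∣ N) :
    (((q + 1 : ℕ) : ℤ) ^ (2 * (k + 1))) ∣
      coprimeProd q N ((q + 1) * (N * c)) - (-1) ^ (c * (q * N)) * coprimeProd q N 0 := by
  rcases eq_or_ne q 1 with rfl | hq
  · simpa [one_add_one_eq_two] using two_pow_dvd_coprimeProd_sub (c := c) hN
  · have hodd : Odd (q + 1) := hp.odd_of_ne_two (by lia)
    have heven : Even q := by simpa [Nat.even_add_one, Nat.odd_add_one] using hodd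
    rw [((heven.mul_right N).mul_left c).neg_one_pow, one_mul]
    exact pow_dvd_coprimeProd_sub_of_odd hp hq hN

lemma mul_choose_sub_one (m : ℕ) {d : ℕ} (hd : 0 < d) :
    (d * m).choose d = m * (d * m - 1).choose (d - 1) := by
  rcases Nat.eq_zero_or_pos m with rfl | hm
  · simp [Nat.choose_eq_zero_of_lt hd]
  have h := Nat.add_one_mul_choose_eq (d * m - 1) (d - 1)
  rw [Nat.sub_add_cancel hd, Nat.sub_add_cancel (Nat.mul_pos hd hm)] at h
  apply Nat.eq_of_mul_eq_mul_left hd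
  lia

lemma prime_pow_dvd_choose_sub {p k N m : ℕ} (hp : p.Prime) (hm : 1 ≤ m) (hN0 : 0 < N)
    (hN : p ^ k ∣ N) :
    ((p : ℤ) ^ (2 * (k + 1))) ∣
      ((p * N * m - 1).choose (p * N - 1) : ℤ) -
        (-1) ^ ((m - 1) * (p * N - N)) * ((N * m - 1).choose (N - 1) : ℤ) := by
  obtain ⟨q, rfl⟩ : ∃ q, p = q + 1 := ⟨p - 1, by have := hp.pos; lia⟩
  obtain ⟨c, rfl⟩ : ∃ c, m = c + 1 := ⟨m - 1, by lia⟩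
  have hsub : (q + 1) * N - N = q * N := by rw [add_one_mul, Nat.add_sub_cancel]
  rw [hsub, Nat.add_sub_cancel]
  have hrel : ((((q + 1) * N * (c + 1) - 1).choose ((q + 1) * N - 1) : ℕ) : ℤ) *
      coprimeProd q N 0 =
      ((N * (c + 1) - 1).choose (N - 1) : ℕ) * coprimeProd q N ((q + 1) * (N * c)) := by
    have h := choose_mul_coprimeProd q N (N * c)
    rw [← mul_add, ← mul_add_one, ← mul_assoc, mul_choose_sub_one _ hN0,
      mul_choose_sub_one _ (Nat.mul_pos q.succ_pos hN0)] at h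
    push_cast at h
    have hc : (c : ℤ) + 1 ≠ 0 := by positivity
    apply mul_left_cancel₀ hc
    linear_combination h
  have hp' := Nat.prime_iff_prime_int.mp hp
  have hcop : IsCoprime (((q + 1 : ℕ) : ℤ) ^ (2 * (k + 1))) (coprimeProd q N 0) :=
    IsCoprime.pow_left (hp'.coprime_iff_not_dvd.mpr (not_dvd_coprimeProd_zero hp N))
  refine hcop.dvd_of_dvd_mul_right ?_
  rw [sub_mul, hrel, mul_assoc, mul_left_comm ((-1 : ℤ) ^ _), ← mul_sub]
  exact (prime_pow_dvd_coprimeProd_sub hp hN).mul_left _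

lemma sum_divisors_prime_pow_mul_moebius {p s : ℕ} (hp : p.Prime) (hs : ¬ p ∣ s) (k : ℕ)
    (F : ℕ → ℤ) :
    ∑ e ∈ (p ^ (k + 1) * s).divisors, ArithmeticFunction.moebius e * F e =
      ∑ t ∈ s.divisors, ArithmeticFunction.moebius t * (F t - F (p * t)) := by
  have hs0 : s ≠ 0 := by rintro rfl; simp at hs
  have hcop {t : ℕ} (ht : t ∣ s) : p.Coprime t :=
    (hp.coprime_iff_not_dvd).mpr fun h => hs (h.trans ht)
  have hdisj : Disjoint s.divisors (s.divisors.image (p * ·)) := by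
    rw [disjoint_left]
    intro e he he'
    obtain ⟨t, -, rfl⟩ := mem_image.mp he'
    exact hs ((dvd_mul_right p t).trans (Nat.dvd_of_mem_divisors he))
  have hsub : s.divisors ∪ s.divisors.image (p * ·) ⊆ (p ^ (k + 1) * s).divisors := by
    intro e he
    rw [Nat.mem_divisors]
    refine ⟨?_, mul_ne_zero (pow_ne_zero _ hp.ne_zero) hs0⟩
    rcases mem_union.mp he with he | he
    · exact (Nat.dvd_of_mem_divisors he).mul_left _
    · obtain ⟨t, ht, rfl⟩ := mem_image.mp he
      exact mul_dvd_mul (dvd_pow_self p k.succ_ne_zero) (Nat.dvd_of_mem_divisors ht)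
  rw [← sum_subset hsub, sum_union hdisj,
    sum_image fun a _ b _ h => Nat.eq_of_mul_eq_mul_left hp.pos h, ← sum_add_distrib]
  · refine sum_congr rfl fun t ht => ?_
    rw [ArithmeticFunction.isMultiplicative_moebius.map_mul_of_coprime
      (hcop (Nat.dvd_of_mem_divisors ht)), ArithmeticFunction.moebius_apply_prime hp]
    ring
  · intro e he hne
    rw [ArithmeticFunction.moebius_eq_zero_of_not_squarefree, zero_mul]
    intro hsq
    apply hne
    have hdvd := Nat.dvd_of_mem_divisors he
    rw [mem_union, mem_image]
    by_cases hpe : p ∣ e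
    · obtain ⟨t, rfl⟩ := hpe
      have hpt : p.Coprime t := Nat.coprime_of_squarefree_mul hsq
      refine Or.inr ⟨t, Nat.mem_divisors.mpr ⟨?_, hs0⟩, rfl⟩
      exact (Nat.Coprime.pow_right _ hpt.symm).dvd_of_dvd_mul_left ((dvd_mul_left t p).trans hdvd)
    · have hpe' := (hp.coprime_iff_not_dvd).mpr hpe
      exact Or.inl (Nat.mem_divisors.mpr
        ⟨(Nat.Coprime.pow_right _ hpe'.symm).dvd_of_dvd_mul_left hdvd, hs0⟩)

lemma prime_pow_dvd_moebius_sum {p s m : ℕ} (hp : p.Prime) (hs : ¬ p ∣ s) (hm : 1 ≤ m) (k : ℕ) :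
    ((p : ℤ) ^ (2 * (k + 1))) ∣ ∑ d ∈ (p ^ (k + 1) * s).divisors,
      ArithmeticFunction.moebius (p ^ (k + 1) * s / d) *
        (-1) ^ ((m - 1) * (p ^ (k + 1) * s - d)) * ((d * m - 1).choose (d - 1) : ℤ) := by
  set n := p ^ (k + 1) * s with hn
  have hs0 : s ≠ 0 := by rintro rfl; simp at hs
  have hflip := Nat.sum_div_divisors n fun e => ArithmeticFunction.moebius e *
    ((-1 : ℤ) ^ ((m - 1) * (n - n / e)) * ((n / e * m - 1).choose (n / e - 1) : ℤ))
  have hsum : ∑ d ∈ n.divisors, ArithmeticFunction.moebius (n / d) *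
        (-1) ^ ((m - 1) * (n - d)) * ((d * m - 1).choose (d - 1) : ℤ) =
      ∑ e ∈ n.divisors, ArithmeticFunction.moebius e *
        ((-1 : ℤ) ^ ((m - 1) * (n - n / e)) * ((n / e * m - 1).choose (n / e - 1) : ℤ)) := by
    rw [← hflip]
    refine sum_congr rfl fun d hd => ?_
    rw [Nat.div_div_self (Nat.dvd_of_mem_divisors hd) (Nat.ne_zero_of_mem_divisors hd), mul_assoc]
  rw [hsum, hn, sum_divisors_prime_pow_mul_moebius hp hs]
  refine dvd_sum fun t ht => Dvd.dvd.mul_left ?_ _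
  obtain ⟨u, rfl⟩ := Nat.dvd_of_mem_divisors ht
  have ht0 : 0 < t := Nat.pos_of_mem_divisors ht
  have hu0 : 0 < u := Nat.pos_of_ne_zero (right_ne_zero_of_mul hs0)
  set N := p ^ k * u with hN
  have hN0 : 0 < N := Nat.mul_pos (pow_pos hp.pos k) hu0
  have h1 : p ^ (k + 1) * (t * u) / t = p * N :=
    Nat.div_eq_of_eq_mul_right ht0 (by rw [hN]; ring)
  have h2 : p ^ (k + 1) * (t * u) / (p * t) = N :=
    Nat.div_eq_of_eq_mul_right (Nat.mul_pos hp.pos ht0) (by rw [hN]; ring)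
  have h3 : p ^ (k + 1) * (t * u) - N = (p ^ (k + 1) * (t * u) - p * N) + (p * N - N) := by
    have : p * N ≤ p ^ (k + 1) * (t * u) := h1 ▸ Nat.div_le_self _ _
    have : N ≤ p * N := Nat.le_mul_of_pos_left _ hp.pos
    lia
  rw [h1, h2, h3, mul_add (m - 1), pow_add (-1 : ℤ), mul_assoc ((-1 : ℤ) ^ _), ← mul_sub]
  exact (prime_pow_dvd_choose_sub hp hm hN0 (dvd_mul_right _ _)).mul_left _

lemma sq_dvd_moebius_sum {m n : ℕ} (hm : 1 ≤ m) (hn : 1 ≤ n) :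
    (n : ℤ) ^ 2 ∣ ∑ d ∈ n.divisors, ArithmeticFunction.moebius (n / d) *
      (-1) ^ ((m - 1) * (n - d)) * ((d * m - 1).choose (d - 1) : ℤ) := by
  rw [← Nat.cast_pow, Int.natCast_dvd, Nat.dvd_iff_prime_pow_dvd_dvd]
  intro p j hp hj
  obtain ⟨e, s, hs, rfl⟩ := Nat.exists_eq_pow_mul_and_not_dvd (by lia : n ≠ 0) p hp.ne_one
  have hcop : (p ^ j).Coprime (s ^ 2) := Nat.Coprime.pow _ _ (hp.coprime_iff_not_dvd.mpr hs)
  rw [mul_pow] at hj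
  replace hj := hcop.dvd_of_dvd_mul_right hj
  refine hj.trans ?_
  rw [← Int.natCast_dvd, ← pow_mul, mul_comm e 2]
  push_cast
  cases e with
  | zero => simp
  | succ k => exact prime_pow_dvd_moebius_sum hp hs hm k

lemma two_mul_choose_le {m d : ℕ} (hm : 2 ≤ m) (hd : 0 < d) :
    2 * (d * m - 1).choose (d - 1) ≤ ((d + 1) * m - 1).choose d :=
  calc 2 * (d * m - 1).choose (d - 1) ≤ m * (d * m - 1).choose (d - 1) :=
        Nat.mul_le_mul_right _ hm
    _ = (d * m).choose d := (mul_choose_sub_one m hd).symm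
    _ ≤ ((d + 1) * m - 1).choose d := Nat.choose_le_choose d (by rw [add_one_mul]; lia)

lemma sum_Ico_choose_le {m : ℕ} (hm : 2 ≤ m) {n : ℕ} (hn : 1 ≤ n) :
    ∑ d ∈ Ico 1 n, (d * m - 1).choose (d - 1) ≤ (n * m - 1).choose (n - 1) := by
  induction n, hn using Nat.le_induction with
  | base => simp
  | succ n hn ih =>
    rw [sum_Ico_succ_top hn, Nat.add_sub_cancel]
    have := two_mul_choose_le hm hn
    lia

lemma moebius_sum_nonneg {m n : ℕ} (hm : 1 ≤ m) (hn : 1 ≤ n) :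
    0 ≤ ∑ d ∈ n.divisors, ArithmeticFunction.moebius (n / d) *
      (-1) ^ ((m - 1) * (n - d)) * ((d * m - 1).choose (d - 1) : ℤ) := by
  rcases hm.eq_or_lt with rfl | hm
  · have h := Nat.sum_div_divisors n fun e => ArithmeticFunction.moebius e
    simp only [Nat.sub_self, zero_mul, pow_zero, mul_one, Nat.choose_self, Nat.cast_one]
    rw [h, ← ArithmeticFunction.coe_mul_zeta_apply, ArithmeticFunction.moebius_mul_coe_zeta,
      ArithmeticFunction.one_apply]
    split_ifs <;> simp
  · rw [← Nat.insert_self_properDivisors (by lia), sum_insert Nat.self_notMem_properDivisors]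
    have hle : |∑ d ∈ n.properDivisors, ArithmeticFunction.moebius (n / d) *
        (-1) ^ ((m - 1) * (n - d)) * ((d * m - 1).choose (d - 1) : ℤ)| ≤
        ((n * m - 1).choose (n - 1) : ℤ) := by
      refine (abs_sum_le_sum_abs _ _).trans ?_
      refine le_trans ?_ (Nat.cast_le.mpr (sum_Ico_choose_le hm hn))
      rw [Nat.cast_sum]
      refine (sum_le_sum fun d _ => ?_).trans
        (sum_le_sum_of_subset_of_nonneg (filter_subset _ _) fun _ _ _ => Nat.cast_nonneg _)
      rw [abs_mul, abs_mul, abs_neg_one_pow, mul_one, Nat.abs_cast]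
      exact mul_le_of_le_one_left (Nat.cast_nonneg _) ArithmeticFunction.abs_moebius_le_one
    rw [Nat.div_self hn, Nat.sub_self, mul_zero, pow_zero, ArithmeticFunction.moebius_apply_one,
      one_mul, one_mul]
    linarith [neg_le_of_abs_le hle]

/-- Theorem 6.5 (Reineke): the generalized Donaldson–Thomas invariant of the
`m`-loop quiver is a natural number, i.e. the Möbius sum is a nonnegative
multiple of `n²`. -/
theorem stmt_3 (m n : ℕ) (hm : 1 ≤ m) (hn : 1 ≤ n) :
    ∃ DT : ℕ,
      ∑ d ∈ n.divisors,
        (ArithmeticFunction.moebius (n / d) : ℤ) * (-1) ^ ((m - 1) * (n - d)) *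
          (Nat.choose (d * m - 1) (d - 1) : ℤ)
        = (n : ℤ) ^ 2 * (DT : ℤ) := by
  obtain ⟨z, hz⟩ := sq_dvd_moebius_sum hm hn
  have hnonneg := moebius_sum_nonneg hm hn
  rw [hz] at hnonneg
  have hz0 : 0 ≤ z := nonneg_of_mul_nonneg_right hnonneg (by positivity)
  exact ⟨z.toNat, by rw [hz, Int.toNat_of_nonneg hz0]⟩
end

section
/- Let w₀ ≥ 1 be an integer and let n, GW, N, m : ℕ≥1 → ℚ satisfy: (a) GW(h) = Σ_{k ∣ h} (1/k³) · n(h/k) for all h ≥ 1; (b) N(h) = (−1)^{h·w₀ − 1} · (h·w₀) · GW(h) for all h ≥ 1; and (c) N(h) = Σ_{k ∣ h} ((−1)^{(k−1)·(h/k)·w₀} / k²) · m(h/k) for all h ≥ 1. Then m(h) = (−1)^{h·w₀ − 1} · (h·w₀) · n(h) for all h ≥ 1. -/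
/-- The sign and weight of the class of degree `k * d` factor through those of degree `d`. -/
lemma sign_mul_weight_mul_eq {w k d : ℕ} (hw : 1 ≤ w) (hk : 1 ≤ k) (hd : 1 ≤ d) (x : ℚ) :
    (-1 : ℚ) ^ (k * d * w - 1) * ((k * d * w : ℕ) : ℚ) * (1 / (k : ℚ) ^ 3 * x) =
      (-1 : ℚ) ^ ((k - 1) * d * w) / (k : ℚ) ^ 2 *
        ((-1 : ℚ) ^ (d * w - 1) * ((d * w : ℕ) : ℚ) * x) := by
  have hdw : 1 ≤ d * w := Nat.mul_pos hd hw
  have hexp : k * d * w - 1 = (k - 1) * d * w + (d * w - 1) := by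
    obtain ⟨j, rfl⟩ := Nat.exists_eq_add_of_le' hk
    have : (j + 1) * d * w = j * d * w + d * w := by ring
    rw [Nat.add_sub_cancel]
    omega
  have hk0 : (k : ℚ) ≠ 0 := by exact_mod_cast (by omega : k ≠ 0)
  rw [hexp, pow_add]
  push_cast
  field_simp

/-- A divisor transform whose coefficients at `k = 1` are nonzero is injective on positive
integers. -/
lemma eq_of_sum_divisors_mul_eq {c : ℕ → ℕ → ℚ} {f g : ℕ → ℚ} (hc : ∀ h, c h 1 ≠ 0)
    (hfg : ∀ h : ℕ, 1 ≤ h →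
      ∑ k ∈ h.divisors, c h k * f (h / k) = ∑ k ∈ h.divisors, c h k * g (h / k)) :
    ∀ h : ℕ, 1 ≤ h → f h = g h := by
  intro h
  induction h using Nat.strong_induction_on with
  | _ h ih =>
    intro hh
    have hone : 1 ∈ h.divisors := Nat.one_mem_divisors.mpr (by omega)
    have htail : ∑ k ∈ h.divisors.erase 1, c h k * f (h / k) =
        ∑ k ∈ h.divisors.erase 1, c h k * g (h / k) := by
      refine Finset.sum_congr rfl fun k hk => ?_
      obtain ⟨hk1, hk⟩ := Finset.mem_erase.mp hk
      have hkpos := Nat.pos_of_mem_divisors hk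
      rw [ih (h / k) (Nat.div_lt_self hh (by omega))
        (Nat.div_pos (Nat.divisor_le hk) hkpos)]
    have hsum := hfg h hh
    rw [← Finset.add_sum_erase _ _ hone, ← Finset.add_sum_erase _ _ hone, htail] at hsum
    simpa [hc h] using hsum

/-- Identity (eq:sum_log_in_local) of the paper: the total log BPS numbers `m`
defined by the multiple cover relation from the log GW invariants `N`, which
in turn are related to the local GW invariants `GW` by the log-local
correspondence, satisfy `m(h) = (−1)^{hw₀−1} (hw₀) n(h)` where `n` is defined
via the Aspinwall–Morrison relation. -/
theorem stmt_8 (w₀ : ℕ) (hw : 1 ≤ w₀) (n GW N m : ℕ → ℚ)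
    (hAM : ∀ h : ℕ, 1 ≤ h →
      GW h = ∑ k ∈ h.divisors, (1 / (k : ℚ) ^ 3) * n (h / k))
    (hN : ∀ h : ℕ, 1 ≤ h →
      N h = (-1 : ℚ) ^ (h * w₀ - 1) * ((h * w₀ : ℕ) : ℚ) * GW h)
    (hm : ∀ h : ℕ, 1 ≤ h →
      N h = ∑ k ∈ h.divisors,
        ((-1 : ℚ) ^ ((k - 1) * (h / k) * w₀) / (k : ℚ) ^ 2) * m (h / k)) :
    ∀ h : ℕ, 1 ≤ h →
      m h = (-1 : ℚ) ^ (h * w₀ - 1) * ((h * w₀ : ℕ) : ℚ) * n h := by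
  refine eq_of_sum_divisors_mul_eq
    (c := fun h k => (-1 : ℚ) ^ ((k - 1) * (h / k) * w₀) / (k : ℚ) ^ 2) (by simp) ?_
  intro h hh
  rw [← hm h hh, hN h hh, hAM h hh, Finset.mul_sum]
  refine Finset.sum_congr rfl fun k hk => ?_
  have hkpos := Nat.pos_of_mem_divisors hk
  have key := sign_mul_weight_mul_eq hw hkpos
    (Nat.div_pos (Nat.divisor_le hk) hkpos) (n (h / k))
  rwa [Nat.mul_div_cancel' (Nat.dvd_of_mem_divisors hk)] at key
end
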